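/- There is no function μ assigning a value in {1,-1} to each of the nine 4×4 matrices X⊗I₂, I₂⊗X, X⊗X, I₂⊗Y, Y⊗I₂, Y⊗Y, X⊗Y, Y⊗X, Z⊗Z such that the product of the μ-values over each row of the Mermin square equals 1, the product over each of the first two columns equals 1, and the product over the third column {X⊗X, Y⊗Y, Z⊗Z} equals -1. (The rows are {X⊗I₂, I₂⊗X, X⊗X}, {I₂⊗Y, Y⊗I₂, Y⊗Y}, {X⊗Y, Y⊗X, Z⊗Z}; the columns are {X⊗I₂, I₂⊗Y, X⊗Y}, {I₂⊗X, Y⊗I₂, Y⊗X}, {X⊗X, Y⊗Y, Z⊗Z}.) -/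

import Mathlib

open Kronecker

namespace MerminNoAssignment

def I₂ : Matrix (Fin 2) (Fin 2) ℂ := !![1, 0; 0, 1]
def X : Matrix (Fin 2) (Fin 2) ℂ := !![0, 1; 1, 0]
def Y : Matrix (Fin 2) (Fin 2) ℂ := !![0, -Complex.I; Complex.I, 0]
def Z : Matrix (Fin 2) (Fin 2) ℂ := !![1, 0; 0, -1]

/-- The entries of a `3 × 3` array cannot have all row products equal to `1` while the column
products are `1`, `1` and `-1`: both families multiply to the product of all entries. -/
theorem mermin_square_parity {a b c d e f g h k : ℤ}
    (row₁ : a * b * c = 1) (row₂ : d * e * f = 1) (row₃ : g * h * k = 1)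
    (col₁ : a * d * g = 1) (col₂ : b * e * h = 1) (col₃ : c * f * k = -1) : False := by
  have products_eq : (a * b * c) * (d * e * f) * (g * h * k) =
      (a * d * g) * (b * e * h) * (c * f * k) := by ring
  rw [row₁, row₂, row₃, col₁, col₂, col₃] at products_eq
  norm_num at products_eq

/-- There is no `±1`-valued assignment `μ` to the nine operators of the Mermin square
whose product over each row and over each of the first two columns is `1` and whose
product over the third column is `-1`. -/
theorem no_mermin_assignment :
    ¬ ∃ μ : Matrix (Fin 2 × Fin 2) (Fin 2 × Fin 2) ℂ → ℤ,
      (∀ M, μ M = 1 ∨ μ M = -1) ∧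
      μ (X ⊗ₖ I₂) * μ (I₂ ⊗ₖ X) * μ (X ⊗ₖ X) = 1 ∧
      μ (I₂ ⊗ₖ Y) * μ (Y ⊗ₖ I₂) * μ (Y ⊗ₖ Y) = 1 ∧
      μ (X ⊗ₖ Y) * μ (Y ⊗ₖ X) * μ (Z ⊗ₖ Z) = 1 ∧
      μ (X ⊗ₖ I₂) * μ (I₂ ⊗ₖ Y) * μ (X ⊗ₖ Y) = 1 ∧
      μ (I₂ ⊗ₖ X) * μ (Y ⊗ₖ I₂) * μ (Y ⊗ₖ X) = 1 ∧
      μ (X ⊗ₖ X) * μ (Y ⊗ₖ Y) * μ (Z ⊗ₖ Z) = -1 := by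
  rintro ⟨μ, -, row₁, row₂, row₃, col₁, col₂, col₃⟩
  exact mermin_square_parity row₁ row₂ row₃ col₁ col₂ col₃

end MerminNoAssignment
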